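/- For the metric g determined by the real constants a, b, p, q, s, the covariant derivative of the Ricci tensor satisfies, for any vector fields u = Σ u^i∂_i, v = Σ v^i∂_i, w = Σ w^i∂_i on ℝ⁴, (∇_u ρ)(v,w) = −(a + b)·u⁴v⁴w⁴; equivalently, ∇_i ρ_{jk} = 0 unless i = j = k = 4, and ∇₄ ρ₄₄ = −(a + b). -/

import Mathlib

noncomputable section

open scoped BigOperators

/-- The metric of a four-dimensional two-symmetric Lorentzian manifold, in
coordinates `x 0 = x¹, x 1 = x², x 2 = x³, x 3 = x⁴`:
`g₁₄ = g₄₁ = g₂₂ = g₃₃ = 1`,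
`g₄₄ = x⁴(a(x²)² + b(x³)²) + p(x²)² + 2q x²x³ + s(x³)²`, all others zero. -/
def gmat (a b p q s : ℝ) (x : Fin 4 → ℝ) : Matrix (Fin 4) (Fin 4) ℝ :=
  Matrix.of fun i j =>
    if i = 0 ∧ j = 3 then 1
    else if i = 3 ∧ j = 0 then 1
    else if i = 1 ∧ j = 1 then 1
    else if i = 2 ∧ j = 2 then 1
    else if i = 3 ∧ j = 3 then
      x 3 * (a * (x 1) ^ 2 + b * (x 2) ^ 2) + p * (x 1) ^ 2
        + 2 * q * x 1 * x 2 + s * (x 2) ^ 2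
    else 0

/-- The inverse matrix `g^{ij}`. -/
def ginv (a b p q s : ℝ) (x : Fin 4 → ℝ) : Matrix (Fin 4) (Fin 4) ℝ :=
  (gmat a b p q s x)⁻¹

/-- Partial derivative `∂_i` of a function on ℝ⁴. -/
def pd (i : Fin 4) (f : (Fin 4 → ℝ) → ℝ) (x : Fin 4 → ℝ) : ℝ :=
  fderiv ℝ f x (Pi.single i 1)

/-- Christoffel symbols `Γ^k_{ij} = (1/2) Σ_l g^{kl}(∂_i g_{jl} + ∂_j g_{il} − ∂_l g_{ij})`. -/
def Gam (a b p q s : ℝ) (k i j : Fin 4) (x : Fin 4 → ℝ) : ℝ :=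
  (1 / 2) * ∑ l, ginv a b p q s x k l *
    (pd i (fun y => gmat a b p q s y j l) x
      + pd j (fun y => gmat a b p q s y i l) x
      - pd l (fun y => gmat a b p q s y i j) x)

/-- Curvature tensor
`R^i_{jkl} = ∂_k Γ^i_{lj} − ∂_l Γ^i_{kj} + Σ_m (Γ^i_{km} Γ^m_{lj} − Γ^i_{lm} Γ^m_{kj})`. -/
def Riem (a b p q s : ℝ) (i j k l : Fin 4) (x : Fin 4 → ℝ) : ℝ :=
  pd k (Gam a b p q s i l j) x - pd l (Gam a b p q s i k j) x
    + ∑ m, (Gam a b p q s i k m x * Gam a b p q s m l j x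
      - Gam a b p q s i l m x * Gam a b p q s m k j x)

/-- Ricci tensor `ρ_{jl} = Σ_i R^i_{jil}`. -/
def Ric (a b p q s : ℝ) (j l : Fin 4) (x : Fin 4 → ℝ) : ℝ :=
  ∑ i, Riem a b p q s i j i l x

/-- Covariant derivative of the Ricci tensor
`∇_i ρ_{jk} = ∂_i ρ_{jk} − Σ_l (Γ^l_{ij} ρ_{lk} + Γ^l_{ik} ρ_{jl})`. -/
def covRic (a b p q s : ℝ) (i j k : Fin 4) (x : Fin 4 → ℝ) : ℝ :=
  pd i (Ric a b p q s j k) x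
    - ∑ l, (Gam a b p q s l i j x * Ric a b p q s l k x
      + Gam a b p q s l i k x * Ric a b p q s j l x)

/-- The only non-constant component `g₄₄` of the metric. -/
def gLast (a b p q s : ℝ) (x : Fin 4 → ℝ) : ℝ :=
  x 3 * (a * (x 1) ^ 2 + b * (x 2) ^ 2) + p * (x 1) ^ 2
    + 2 * q * x 1 * x 2 + s * (x 2) ^ 2

/-- The gradient of `gLast`. -/
def gLastGrad (a b p q s : ℝ) (i : Fin 4) (x : Fin 4 → ℝ) : ℝ :=
  ![0,
    2 * a * (x 3 * x 1) + 2 * p * x 1 + 2 * q * x 2,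
    2 * b * (x 3 * x 2) + 2 * q * x 1 + 2 * s * x 2,
    a * (x 1) ^ 2 + b * (x 2) ^ 2] i

lemma gmat_eq (a b p q s : ℝ) (x : Fin 4 → ℝ) :
    gmat a b p q s x =
      !![0, 0, 0, 1; 0, 1, 0, 0; 0, 0, 1, 0; 1, 0, 0, gLast a b p q s x] := by
  ext i j
  fin_cases i <;> fin_cases j <;> simp [gmat, gLast]

lemma ginv_eq (a b p q s : ℝ) (x : Fin 4 → ℝ) :
    ginv a b p q s x =
      !![-gLast a b p q s x, 0, 0, 1; 0, 1, 0, 0; 0, 0, 1, 0; 1, 0, 0, 0] := by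
  rw [ginv, gmat_eq]
  apply Matrix.inv_eq_right_inv
  ext i j
  fin_cases i <;> fin_cases j <;> simp [Matrix.mul_apply, Fin.sum_univ_four]

lemma pd_const (i : Fin 4) (c : ℝ) (x : Fin 4 → ℝ) : pd i (fun _ => c) x = 0 := by
  simp [pd]

lemma pd_coord (i j : Fin 4) (x : Fin 4 → ℝ) :
    pd i (fun y => y j) x = if j = i then 1 else 0 := by
  rw [pd, (hasFDerivAt_apply j x).fderiv]
  simp [Pi.single_apply]

lemma pd_add (i : Fin 4) {f g : (Fin 4 → ℝ) → ℝ} {x : Fin 4 → ℝ}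
    (hf : DifferentiableAt ℝ f x) (hg : DifferentiableAt ℝ g x) :
    pd i (fun y => f y + g y) x = pd i f x + pd i g x := by
  simp [pd, fderiv_fun_add hf hg]

lemma pd_neg (i : Fin 4) (f : (Fin 4 → ℝ) → ℝ) (x : Fin 4 → ℝ) :
    pd i (fun y => -f y) x = -pd i f x := by
  simp [pd, fderiv_fun_neg]

lemma pd_mul (i : Fin 4) {f g : (Fin 4 → ℝ) → ℝ} {x : Fin 4 → ℝ}
    (hf : DifferentiableAt ℝ f x) (hg : DifferentiableAt ℝ g x) :
    pd i (fun y => f y * g y) x = f x * pd i g x + g x * pd i f x := by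
  simp [pd, fderiv_fun_mul hf hg]

lemma pd_const_mul (i : Fin 4) (c : ℝ) {f : (Fin 4 → ℝ) → ℝ} {x : Fin 4 → ℝ}
    (hf : DifferentiableAt ℝ f x) :
    pd i (fun y => c * f y) x = c * pd i f x := by
  rw [pd_mul i (by fun_prop) hf, pd_const, mul_zero, add_zero]

lemma pd_gLast (a b p q s : ℝ) (i : Fin 4) (x : Fin 4 → ℝ) :
    pd i (gLast a b p q s) x = gLastGrad a b p q s i x := by
  unfold gLast
  simp only [pow_two]
  simp (disch := fun_prop) only [pd_add, pd_mul, pd_const, pd_coord]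
  fin_cases i <;> simp [gLastGrad] <;> ring

lemma pd_gmat (a b p q s : ℝ) (i j l : Fin 4) (x : Fin 4 → ℝ) :
    pd i (fun y => gmat a b p q s y j l) x =
      if j = 3 ∧ l = 3 then gLastGrad a b p q s i x else 0 := by
  simp only [gmat_eq]
  fin_cases j <;> fin_cases l <;> simp [pd_const]
  exact pd_gLast a b p q s i x

lemma Gam_eq (a b p q s : ℝ) (k i j : Fin 4) :
    Gam a b p q s k i j = fun x =>
      if k = 0 ∧ i = 3 then 1 / 2 * gLastGrad a b p q s j x
      else if k = 0 ∧ j = 3 then 1 / 2 * gLastGrad a b p q s i x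
      else if k ≠ 3 ∧ i = 3 ∧ j = 3 then -(1 / 2 * gLastGrad a b p q s k x)
      else 0 := by
  funext x
  simp only [Gam, pd_gmat, ginv_eq, Fin.sum_univ_four]
  fin_cases k <;> fin_cases i <;> fin_cases j <;> simp [gLastGrad] <;> ring

/-- The Ricci tensor is `ρ₄₄ (dx⁴)²`, where `ρ₄₄` is minus half the transverse Laplacian
of `g₄₄`. -/
lemma Ric_eq (a b p q s : ℝ) (j l : Fin 4) :
    Ric a b p q s j l = fun x =>
      if j = 3 ∧ l = 3 then -((a + b) * x 3 + (p + s)) else 0 := by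
  funext x
  simp only [Ric, Riem, Gam_eq, Fin.sum_univ_four]
  fin_cases j <;> fin_cases l <;>
    simp (disch := fun_prop) [gLastGrad, pow_two, pd_const, pd_neg, pd_const_mul, pd_add,
      pd_mul, pd_coord]
  all_goals ring

lemma covRic_eq (a b p q s : ℝ) (i j k : Fin 4) (x : Fin 4 → ℝ) :
    covRic a b p q s i j k x = if i = 3 ∧ j = 3 ∧ k = 3 then -(a + b) else 0 := by
  simp only [covRic, Ric_eq, Gam_eq, Fin.sum_univ_four]
  fin_cases j <;> fin_cases k <;>
    simp (disch := fun_prop) [pd_const, pd_neg, pd_const_mul, pd_add, pd_coord]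
  fin_cases i <;> simp

/-- the covariant derivative of the Ricci tensor satisfies
`∇_i ρ_{jk} = 0` unless `i = j = k = 4`, and `∇₄ ρ₄₄ = −(a + b)`; equivalently, for any
vector fields `u, v, w`, `(∇_u ρ)(v,w) = −(a + b) u⁴v⁴w⁴`. -/
theorem covariant_derivative_ricci (a b p q s : ℝ) :
    (∀ (x : Fin 4 → ℝ) (i j k : Fin 4),
      covRic a b p q s i j k x = if i = 3 ∧ j = 3 ∧ k = 3 then -(a + b) else 0) ∧
    (∀ (x : Fin 4 → ℝ) (u v w : Fin 4 → (Fin 4 → ℝ) → ℝ),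
      (∑ i, ∑ j, ∑ k, u i x * v j x * w k x * covRic a b p q s i j k x) =
        -(a + b) * (u 3 x * v 3 x * w 3 x)) := by
  refine ⟨fun x i j k => covRic_eq a b p q s i j k x, fun x u v w => ?_⟩
  simp only [covRic_eq, Fin.sum_univ_four]
  simp
  ring
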